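/- arXiv:1504.05288 — 3 statements merged into one kernel-verified Lean document; each statement's English description precedes it below -/
import Mathlib

section
/- Let g : ℝ → ℝ be a measurable function with g(x) ∈ {0, 1} for all x, and define s(x) := ∫₀ˣ g(t) dt (with the sign convention s(x) = −∫ₓ⁰ g for x < 0). Assume s is strictly increasing. Let J := s(ℝ), which is an open interval, and let φ : ℝ → ℝ be continuously differentiable with compact support contained in J. Define u := φ ∘ s. Then: (i) u is Lipschitz continuous with compact support; (ii) for Lebesgue-almost every x ∈ ℝ, u is differentiable at x with u'(x) = φ'(s(x)) · g(x); (iii) ∫_ℝ u'(x)² dx = ∫_J φ'(t)² dt. -/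
open MeasureTheory
open Set Function Filter

/-- A Lipschitz map of the real line sends Lebesgue null sets to Lebesgue null sets. -/
theorem LipschitzWith.volume_image_eq_zero {K : NNReal} {f : ℝ → ℝ} (hf : LipschitzWith K f)
    {N : Set ℝ} (hN : volume N = 0) : volume (f '' N) = 0 := by
  have h := hf.hausdorffMeasure_image_le (d := 1) zero_le_one N
  rw [hausdorffMeasure_real] at h
  simpa [hN] using h

/-- The integral function of a function bounded by `K` is `K`-Lipschitz. -/
theorem lipschitzWith_integral_of_norm_le {K : NNReal} {g : ℝ → ℝ}
    (hg : ∀ a b, IntervalIntegrable g volume a b) (hK : ∀ x, ‖g x‖ ≤ K) (c : ℝ) :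
    LipschitzWith K (fun x => ∫ t in c..x, g t) := by
  refine LipschitzWith.of_dist_le_mul fun x y => ?_
  rw [Real.dist_eq, Real.dist_eq, intervalIntegral.integral_interval_sub_left (hg _ _) (hg _ _)]
  exact intervalIntegral.norm_integral_le_of_norm_le_const fun t _ => hK t

/-- Change of variables for an injective Lipschitz function with a known derivative almost
everywhere. -/
theorem integral_range_eq_integral_abs_deriv_mul {K : NNReal} {s g : ℝ → ℝ}
    (hs : LipschitzWith K s) (hinj : Injective s) (hderiv : ∀ᵐ x, HasDerivAt s (g x) x)
    (f : ℝ → ℝ) : ∫ t in range s, f t = ∫ x, |g x| * f (s x) := by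
  obtain ⟨A, hA, hA_meas, hA_null⟩ := exists_measurable_superset_of_null (ae_iff.mp hderiv)
  have hderivA : ∀ x ∈ Aᶜ, HasDerivWithinAt s (g x) Aᶜ x := fun x hx =>
    (not_not.mp fun h => hx (hA h)).hasDerivWithinAt
  have h_image : s '' Aᶜ =ᵐ[volume] range s := by
    rw [image_compl_eq_range_sdiff_image hinj]
    exact sdiff_null_ae_eq_self (hs.volume_image_eq_zero hA_null)
  have h_compl : (Aᶜ : Set ℝ) =ᵐ[volume] univ := by
    rw [compl_eq_univ_sdiff]
    exact sdiff_null_ae_eq_self hA_null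
  rw [← setIntegral_congr_set h_image,
    integral_image_eq_integral_abs_deriv_smul hA_meas.compl hderivA hinj.injOn,
    setIntegral_congr_set h_compl, setIntegral_univ]
  rfl

/-- Composing a compactly supported function with a continuous strictly monotone one whose range
contains the support yields a compactly supported function. -/
theorem HasCompactSupport.comp_strictMono {φ s : ℝ → ℝ} (hφ : HasCompactSupport φ)
    (hs : Continuous s) (hmono : StrictMono s) (hsupp : tsupport φ ⊆ range s) :
    HasCompactSupport (φ ∘ s) := by
  have hemb := hmono.isEmbedding_of_ordConnected (isPreconnected_range hs).ordConnected
  refine HasCompactSupport.intro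
    ((hemb.isInducing.isCompact_preimage_iff hsupp).mpr hφ) fun x hx => ?_
  exact image_eq_zero_of_notMem_tsupport (f := φ) hx

/-- Theorem 3.1 (parts (2)-(3)) of the paper, restricted to the core: for a scale function
`s(x) = ∫₀ˣ g` with `g ∈ {0,1}`, `s` strictly increasing, and `φ ∈ C_c¹(s(ℝ))`, the
function `u = φ ∘ s` is Lipschitz with compact support, differentiable a.e. with
`u'(x) = φ'(s(x)) g(x)`, and its Dirichlet energy satisfies `∫ u'² dx = ∫_J φ'² dt`. -/
theorem scale_function_core_energy
    (g : ℝ → ℝ) (hg_meas : Measurable g) (hg01 : ∀ x, g x = 0 ∨ g x = 1)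
    (s : ℝ → ℝ) (hs : ∀ x, s x = ∫ t in (0:ℝ)..x, g t)
    (hmono : StrictMono s)
    (J : Set ℝ) (hJ : J = Set.range s)
    (φ : ℝ → ℝ) (hφ : ContDiff ℝ 1 φ) (hφs : HasCompactSupport φ)
    (hsuppφ : tsupport φ ⊆ J)
    (u : ℝ → ℝ) (hu : ∀ x, u x = φ (s x)) :
    (∃ L : NNReal, LipschitzWith L u) ∧ HasCompactSupport u ∧
    (∀ᵐ x : ℝ, HasDerivAt u (deriv φ (s x) * g x) x) ∧
    ∫ x : ℝ, (deriv u x) ^ 2 = ∫ t in J, (deriv φ t) ^ 2 := by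
  obtain rfl : s = fun x => ∫ t in (0:ℝ)..x, g t := funext hs
  set s : ℝ → ℝ := fun x => ∫ t in (0:ℝ)..x, g t
  obtain rfl : u = φ ∘ s := funext hu
  subst hJ
  have hg_norm : ∀ x, ‖g x‖ ≤ (1 : NNReal) := fun x => by rcases hg01 x with h | h <;> simp [h]
  have hg_loc : LocallyIntegrable g volume :=
    (locallyIntegrable_const (1 : ℝ)).mono hg_meas.aestronglyMeasurable
      (Eventually.of_forall fun x => by simpa using hg_norm x)
  have hs_lip : LipschitzWith 1 s := lipschitzWith_integral_of_norm_le
    (fun a b => (hg_loc.integrableOn_isCompact isCompact_uIcc).intervalIntegrable) hg_norm 0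
  have hs_deriv : ∀ᵐ x, HasDerivAt s (g x) x := by
    filter_upwards [_root_.LocallyIntegrable.ae_hasDerivAt_integral hg_loc] with x hx using hx 0
  have hu_deriv : ∀ᵐ x, HasDerivAt (φ ∘ s) (deriv φ (s x) * g x) x := by
    filter_upwards [hs_deriv] with x hx
    exact (hφ.differentiable one_ne_zero (s x)).hasDerivAt.comp x hx
  obtain ⟨L, hL⟩ := hφ.lipschitzWith_of_hasCompactSupport hφs one_ne_zero
  refine ⟨⟨L * 1, hL.comp hs_lip⟩, hφs.comp_strictMono hs_lip.continuous hmono hsuppφ,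
    hu_deriv, ?_⟩
  rw [integral_range_eq_integral_abs_deriv_mul hs_lip hmono.injective hs_deriv]
  refine integral_congr_ae ?_
  filter_upwards [hu_deriv] with x hx
  rw [hx.deriv]
  rcases hg01 x with h | h <;> simp [h]
end

section
/- Let E be a locally compact metric space. Call a function T : ℝ → ℝ a normal contraction if T(0) = 0 and |T(a) − T(b)| ≤ |a − b| for all a, b. Let D ⊆ C_c(E) be a set of continuous compactly supported real-valued functions on E that is dense in C_c(E) with respect to the uniform norm and is stable under normal contractions (i.e., T ∘ u ∈ D whenever u ∈ D and T is a normal contraction). Then for every open set G ⊆ E with compact closure there exists u ∈ D with 0 ≤ u(x) ≤ 1 for all x ∈ E and u(x) = 1 for all x in the closure of G. -/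
/-- Cutoff-function construction in the proof of Theorem 2.2: if `D ⊆ C_c(E)` is uniformly
dense in `C_c(E)` and stable under normal contractions, then for every relatively compact
open set `G` there is `u ∈ D` with `0 ≤ u ≤ 1` and `u ≡ 1` on the closure of `G`. -/
theorem cutoff_in_contraction_stable_dense_subset
    {E : Type*} [MetricSpace E] [LocallyCompactSpace E]
    (D : Set (E → ℝ))
    (hDcc : ∀ u ∈ D, Continuous u ∧ HasCompactSupport u)
    (hdense : ∀ f : E → ℝ, Continuous f → HasCompactSupport f → ∀ ε > 0,
      ∃ u ∈ D, ∀ x, |u x - f x| < ε)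
    (hstable : ∀ u ∈ D, ∀ T : ℝ → ℝ, T 0 = 0 → (∀ a b, |T a - T b| ≤ |a - b|) →
      (T ∘ u) ∈ D)
    (G : Set E) (hG : IsOpen G) (hGc : IsCompact (closure G)) :
    ∃ u ∈ D, (∀ x, 0 ≤ u x ∧ u x ≤ 1) ∧ ∀ x ∈ closure G, u x = 1 := by
  obtain ⟨f, hf_one, -, hf_supp, -⟩ :=
    exists_continuous_one_zero_of_isCompact hGc isClosed_empty (Set.disjoint_empty _)
  obtain ⟨u, hu, hu_near⟩ := hdense (fun x ↦ 2 * f x) (by fun_prop) hf_supp.mul_left 1 one_pos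
  refine ⟨_, hstable u hu (fun t ↦ max 0 (min t 1)) (by simp) (fun a b ↦ ?_),
    fun x ↦ ⟨le_max_left _ _, max_le zero_le_one (min_le_right _ _)⟩, fun x hx ↦ ?_⟩
  · calc |max 0 (min a 1) - max 0 (min b 1)| ≤ |min a 1 - min b 1| := by
          simpa using abs_max_sub_max_le_max 0 (min a 1) 0 (min b 1)
      _ ≤ |a - b| := by simpa using abs_min_sub_min_le_max a 1 b 1
  · have hfx : f x = 1 := hf_one hx
    have hux : 1 ≤ u x := by
      have h_near := (abs_lt.mp (hu_near x)).1
      rw [hfx] at h_near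
      linarith
    simp [min_eq_right hux]
end

section
/- For i = 1, …, d let g_i : ℝ → ℝ be measurable with g_i(x) ∈ {0,1} for all x, define s_i(x) := ∫₀ˣ g_i(t) dt, assume each s_i is strictly increasing, set J_i := s_i(ℝ), and let φ_i : ℝ → ℝ be continuously differentiable with compact support contained in J_i. Define u : ℝ^d → ℝ by u(x) := Π_{i=1}^d φ_i(s_i(x_i)). Then u is Lipschitz continuous with compact support; for Lebesgue-almost every x ∈ ℝ^d and every i, ∂u/∂x_i(x) = φ_i'(s_i(x_i)) g_i(x_i) Π_{j≠i} φ_j(s_j(x_j)); and ½ ∫_{ℝ^d} |∇u(x)|² dx = Σ_{i=1}^d ½ (∫_{J_i} φ_i'(t)² dt) · Π_{j≠i} ∫_ℝ φ_j(s_j(x_j))² dx_j. -/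
open MeasureTheory

namespace LipschitzWith

/-- Lipschitz self-maps of the real line send Lebesgue null sets to Lebesgue null sets. -/
theorem volume_image_eq_zero_s11 {K : NNReal} {f : ℝ → ℝ} (hf : LipschitzWith K f) {A : Set ℝ}
    (hA : volume A = 0) : volume (f '' A) = 0 := by
  have h := hf.hausdorffMeasure_image_le zero_le_one A
  rw [hausdorffMeasure_real, hA, mul_zero] at h
  exact le_antisymm h zero_le

/-- A monotone Lipschitz function maps a measurable set of full measure on which it is
differentiable onto almost all of its range. -/
theorem exists_image_ae_eq_range {K : NNReal} {f f' : ℝ → ℝ} (hf : LipschitzWith K f)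
    (hf' : ∀ᵐ x, HasDerivAt f (f' x) x) :
    ∃ D : Set ℝ, MeasurableSet D ∧ (∀ x ∈ D, HasDerivWithinAt f (f' x) D x) ∧
      D =ᵐ[volume] Set.univ ∧ f '' D =ᵐ[volume] Set.range f := by
  obtain ⟨D, hD, hDm, hDd⟩ := hf'.exists_measurable_mem
  refine ⟨D, hDm, fun x hx => (hDd x hx).hasDerivWithinAt, Filter.eventuallyEq_univ.2 hD, ?_⟩
  refine (Set.image_subset_range f D).eventuallyLE.antisymm (ae_le_set.2 ?_)
  refine measure_mono_null ?_ (hf.volume_image_eq_zero_s11 hD)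
  rintro _ ⟨⟨x, rfl⟩, hx⟩
  exact ⟨x, fun h => hx ⟨x, h, rfl⟩, rfl⟩

theorem integral_range_eq_integral_deriv_smul {K : NNReal} {f f' : ℝ → ℝ}
    (hf : LipschitzWith K f) (hm : Monotone f) (hf' : ∀ᵐ x, HasDerivAt f (f' x) x) (h : ℝ → ℝ) :
    ∫ t in Set.range f, h t = ∫ x, f' x • h (f x) := by
  obtain ⟨D, hDm, hDd, hD, hr⟩ := hf.exists_image_ae_eq_range hf'
  rw [← setIntegral_congr_set hr,
    integral_image_eq_integral_deriv_smul_of_monotoneOn hDm hDd (hm.monotoneOn D),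
    setIntegral_congr_set hD, setIntegral_univ]

theorem integrableOn_range_iff_integrable_deriv_smul {K : NNReal} {f f' : ℝ → ℝ}
    (hf : LipschitzWith K f) (hm : Monotone f) (hf' : ∀ᵐ x, HasDerivAt f (f' x) x) (h : ℝ → ℝ) :
    IntegrableOn h (Set.range f) ↔ Integrable fun x => f' x • h (f x) := by
  obtain ⟨D, hDm, hDd, hD, hr⟩ := hf.exists_image_ae_eq_range hf'
  rw [← integrableOn_congr_set_ae hr,
    integrableOn_image_iff_integrableOn_deriv_smul_of_monotoneOn hDm hDd (hm.monotoneOn D),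
    integrableOn_congr_set_ae hD, integrableOn_univ]

end LipschitzWith

theorem lipschitzWith_intervalIntegral {g : ℝ → ℝ} {C : NNReal} (hg : LocallyIntegrable g)
    (hC : ∀ x, ‖g x‖ ≤ C) (a : ℝ) : LipschitzWith C fun x => ∫ t in a..x, g t := by
  have hint : ∀ x y, IntervalIntegrable g volume x y := fun x y =>
    intervalIntegrable_iff.2
      ((hg.integrableOn_isCompact isCompact_uIcc).mono_set Set.uIoc_subset_uIcc)
  refine LipschitzWith.of_dist_le_mul fun x y => ?_
  rw [Real.dist_eq, Real.dist_eq, intervalIntegral.integral_interval_sub_left (hint a x) (hint a y)]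
  exact intervalIntegral.norm_integral_le_of_norm_le_const fun t _ => hC t

theorem StrictMono.hasCompactSupport_comp {f φ : ℝ → ℝ} (hm : StrictMono f) (hc : Continuous f)
    (hφ : HasCompactSupport φ) (hs : tsupport φ ⊆ Set.range f) :
    HasCompactSupport fun x => φ (f x) := by
  have hemb := hm.isEmbedding_of_ordConnected
    (isPreconnected_iff_ordConnected.1 (isPreconnected_range hc))
  refine HasCompactSupport.intro (hemb.isInducing.isCompact_preimage' hφ hs) fun x hx => ?_
  exact image_eq_zero_of_notMem_tsupport hx

theorem integrable_sq_of_hasCompactSupport {f : ℝ → ℝ} (hc : Continuous f)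
    (hf : HasCompactSupport f) : Integrable fun x => f x ^ 2 := by
  have hf2 : HasCompactSupport fun x => f x ^ 2 :=
    HasCompactSupport.intro hf fun x hx => by simp [image_eq_zero_of_notMem_tsupport hx]
  have hc2 : Continuous fun x => f x ^ 2 := by fun_prop
  exact hc2.integrable_of_hasCompactSupport hf2

theorem HasCompactSupport.fintype_prod {ι : Type*} [Fintype ι] {X : ι → Type*}
    [∀ i, TopologicalSpace (X i)] [∀ i, R1Space (X i)] {f : ∀ i, X i → ℝ}
    (hf : ∀ i, HasCompactSupport (f i)) : HasCompactSupport fun x : ∀ i, X i => ∏ i, f i (x i) := by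
  refine HasCompactSupport.intro (isCompact_univ_pi hf) fun x hx => ?_
  obtain ⟨i, hi⟩ : ∃ i, x i ∉ tsupport (f i) := by simpa using hx
  exact Finset.prod_eq_zero (Finset.mem_univ i) (image_eq_zero_of_notMem_tsupport hi)

theorem exists_lipschitzWith_prod_comp {ι : Type*} [Fintype ι] {φ s : ι → ℝ → ℝ} {K : NNReal}
    (hφ : ∀ i, ContDiff ℝ 1 (φ i)) (hφs : ∀ i, HasCompactSupport (φ i))
    (hs : ∀ i, LipschitzWith K (s i)) :
    ∃ L : NNReal, LipschitzWith L fun x : ι → ℝ => ∏ i, φ i (s i (x i)) := by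
  have hP : ContDiff ℝ 1 fun y : ι → ℝ => ∏ i, φ i (y i) :=
    contDiff_prod fun i _ => (hφ i).comp (contDiff_apply ℝ ℝ i)
  obtain ⟨C, hC⟩ := ContDiff.lipschitzWith_of_hasCompactSupport
    (HasCompactSupport.fintype_prod hφs) hP one_ne_zero
  have hS : LipschitzWith K fun (x : ι → ℝ) i => s i (x i) :=
    LipschitzWith.of_dist_le_mul fun x y => (dist_pi_le_iff (by positivity)).2 fun i =>
      ((hs i).dist_le_mul _ _).trans (by gcongr; exact dist_le_pi_dist x y i)
  exact ⟨C * K, hC.comp hS⟩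

theorem Finset.prod_update_apply {ι : Type*} [Fintype ι] [DecidableEq ι] (f : ι → ℝ → ℝ)
    (x : ι → ℝ) (i : ι) (t : ℝ) :
    ∏ j, f j (Function.update x i t j) = f i t * ∏ j ∈ Finset.univ.erase i, f j (x j) := by
  rw [← Finset.mul_prod_erase Finset.univ _ (Finset.mem_univ i), Function.update_self]
  congr 1
  exact Finset.prod_congr rfl fun j hj => by rw [Function.update_of_ne (Finset.ne_of_mem_erase hj)]

theorem Finset.prod_update_eq_mul_prod_erase {ι α : Type*} [Fintype ι] [DecidableEq ι]
    (f : ι → α → ℝ) (i : ι) (h : α → ℝ) (x : ι → α) :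
    ∏ j, Function.update f i h j (x j) = h (x i) * ∏ j ∈ Finset.univ.erase i, f j (x j) := by
  rw [← Finset.mul_prod_erase Finset.univ _ (Finset.mem_univ i), Function.update_self]
  congr 1
  exact Finset.prod_congr rfl fun j hj => by rw [Function.update_of_ne (Finset.ne_of_mem_erase hj)]

theorem integrable_mul_prod_erase {ι : Type*} [Fintype ι] [DecidableEq ι] {f : ι → ℝ → ℝ}
    (hf : ∀ i, Integrable (f i)) {h : ℝ → ℝ} (hh : Integrable h) (i : ι) :
    Integrable fun x : ι → ℝ => h (x i) * ∏ j ∈ Finset.univ.erase i, f j (x j) := by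
  simp_rw [← Finset.prod_update_eq_mul_prod_erase]
  refine Integrable.fintype_prod fun j => ?_
  rcases eq_or_ne j i with rfl | hj
  · rwa [Function.update_self]
  · rw [Function.update_of_ne hj]; exact hf j

theorem integral_mul_prod_erase {ι : Type*} [Fintype ι] [DecidableEq ι] (f : ι → ℝ → ℝ)
    (h : ℝ → ℝ) (i : ι) :
    ∫ x : ι → ℝ, h (x i) * ∏ j ∈ Finset.univ.erase i, f j (x j) =
      (∫ t, h t) * ∏ j ∈ Finset.univ.erase i, ∫ t, f j t := by
  simp_rw [← Finset.prod_update_eq_mul_prod_erase]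
  rw [integral_fintype_prod_volume_eq_prod,
    ← Finset.mul_prod_erase Finset.univ _ (Finset.mem_univ i), Function.update_self]
  congr 1
  exact Finset.prod_congr rfl fun j hj => by rw [Function.update_of_ne (Finset.ne_of_mem_erase hj)]

/-- Core computation behind Theorem 3.2: for scale functions `sᵢ(x) = ∫₀ˣ gᵢ` with
`gᵢ ∈ {0,1}`, `sᵢ` strictly increasing, and `φᵢ ∈ C_c¹(Jᵢ)` with `Jᵢ = sᵢ(ℝ)`, the tensor
function `u(x) = Πᵢ φᵢ(sᵢ(xᵢ))` is Lipschitz with compact support, its partial derivatives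
exist a.e. with the product-rule formula, and its Dirichlet energy `½∫|∇u|²` equals the
independent-coupling energy `Σᵢ ½(∫_{Jᵢ} φᵢ'²) Π_{j≠i} ∫ φⱼ(sⱼ)²`. -/
theorem tensor_core_energy_identity
    (d : ℕ) (g : Fin d → ℝ → ℝ)
    (hg_meas : ∀ i, Measurable (g i)) (hg01 : ∀ i x, g i x = 0 ∨ g i x = 1)
    (s : Fin d → ℝ → ℝ) (hs : ∀ i x, s i x = ∫ t in (0:ℝ)..x, g i t)
    (hmono : ∀ i, StrictMono (s i))
    (J : Fin d → Set ℝ) (hJ : ∀ i, J i = Set.range (s i))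
    (φ : Fin d → ℝ → ℝ) (hφ : ∀ i, ContDiff ℝ 1 (φ i))
    (hφs : ∀ i, HasCompactSupport (φ i)) (hsuppφ : ∀ i, tsupport (φ i) ⊆ J i)
    (u : (Fin d → ℝ) → ℝ) (hu : ∀ x, u x = ∏ i, φ i (s i (x i))) :
    (∃ L : NNReal, LipschitzWith L u) ∧ HasCompactSupport u ∧
    (∀ᵐ x : Fin d → ℝ, ∀ i : Fin d,
      HasDerivAt (fun t => u (Function.update x i t))
        (deriv (φ i) (s i (x i)) * g i (x i) *
          ∏ j ∈ Finset.univ.erase i, φ j (s j (x j))) (x i)) ∧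
    (1 / 2) * ∫ x : Fin d → ℝ,
        ∑ i, (deriv (fun t => u (Function.update x i t)) (x i)) ^ 2
      = ∑ i, (1 / 2) * (∫ t in J i, (deriv (φ i) t) ^ 2) *
          ∏ j ∈ Finset.univ.erase i, ∫ y : ℝ, (φ j (s j y)) ^ 2 := by
  obtain rfl : u = fun x => ∏ i, φ i (s i (x i)) := funext hu
  have hbd : ∀ i x, ‖g i x‖ ≤ (1 : NNReal) := fun i x => by
    rcases hg01 i x with h | h <;> simp [h]
  have hloc : ∀ i, LocallyIntegrable (g i) := fun i =>
    (locallyIntegrable_const (1 : ℝ)).mono (hg_meas i).aestronglyMeasurable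
      (ae_of_all _ fun x => by simpa using hbd i x)
  have hs' : ∀ i, s i = fun x => ∫ t in (0 : ℝ)..x, g i t := fun i => funext (hs i)
  have hlip : ∀ i, LipschitzWith 1 (s i) := fun i => by
    rw [hs']; exact lipschitzWith_intervalIntegral (hloc i) (hbd i) 0
  have hder : ∀ i, ∀ᵐ x, HasDerivAt (s i) (g i x) x := fun i => by
    rw [hs']
    filter_upwards [LocallyIntegrable.ae_hasDerivAt_integral (hloc i)] with x hx using hx 0
  have hcs : ∀ i, HasCompactSupport fun x => φ i (s i x) := fun i =>
    (hmono i).hasCompactSupport_comp (hlip i).continuous (hφs i) (hJ i ▸ hsuppφ i)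
  have hpartial : ∀ᵐ x : Fin d → ℝ, ∀ i : Fin d,
      HasDerivAt (fun t => ∏ j, φ j (s j (Function.update x i t j)))
        (deriv (φ i) (s i (x i)) * g i (x i) *
          ∏ j ∈ Finset.univ.erase i, φ j (s j (x j))) (x i) := by
    rw [ae_all_iff]
    intro i
    filter_upwards [(Measure.quasiMeasurePreserving_eval (fun _ : Fin d => (volume : Measure ℝ))
      i).ae (hder i)] with x hx
    simp_rw [Finset.prod_update_apply (fun j t => φ j (s j t))]
    exact ((((hφ i).differentiable one_ne_zero).differentiableAt.hasDerivAt).comp (x i)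
      hx).mul_const _
  refine ⟨exists_lipschitzWith_prod_comp hφ hφs hlip,
    HasCompactSupport.fintype_prod (f := fun i y => φ i (s i y)) hcs, hpartial, ?_⟩
  beta_reduce
  have hsq : ∀ i, Integrable fun y => φ i (s i y) ^ 2 := fun i =>
    integrable_sq_of_hasCompactSupport ((hφ i).continuous.comp (hlip i).continuous) (hcs i)
  have hdsq : ∀ i, Integrable fun y => g i y • deriv (φ i) (s i y) ^ 2 := fun i =>
    ((hlip i).integrableOn_range_iff_integrable_deriv_smul (hmono i).monotone (hder i)
      fun t => deriv (φ i) t ^ 2).1 (integrable_sq_of_hasCompactSupport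
        ((hφ i).continuous_deriv le_rfl) (hφs i).deriv).integrableOn
  have hgrad : (fun x : Fin d → ℝ =>
      ∑ i, deriv (fun t => ∏ j, φ j (s j (Function.update x i t j))) (x i) ^ 2) =ᵐ[volume]
      fun x => ∑ i, (g i (x i) • deriv (φ i) (s i (x i)) ^ 2) *
        ∏ j ∈ Finset.univ.erase i, φ j (s j (x j)) ^ 2 := by
    filter_upwards [hpartial] with x hx
    refine Finset.sum_congr rfl fun i _ => ?_
    rw [(hx i).deriv, Finset.prod_pow]
    rcases hg01 i (x i) with h | h <;> simp [h, mul_pow]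
  have hint : ∀ i, Integrable fun x : Fin d → ℝ => (g i (x i) • deriv (φ i) (s i (x i)) ^ 2) *
      ∏ j ∈ Finset.univ.erase i, φ j (s j (x j)) ^ 2 := fun i =>
    integrable_mul_prod_erase (f := fun j y => φ j (s j y) ^ 2)
      (h := fun y => g i y • deriv (φ i) (s i y) ^ 2) hsq (hdsq i) i
  rw [integral_congr_ae hgrad, integral_finsetSum _ fun i _ => hint i, Finset.mul_sum]
  refine Finset.sum_congr rfl fun i _ => ?_
  rw [integral_mul_prod_erase (fun j y => φ j (s j y) ^ 2)
    (fun y => g i y • deriv (φ i) (s i y) ^ 2), hJ,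
    (hlip i).integral_range_eq_integral_deriv_smul (hmono i).monotone (hder i), mul_assoc]
end
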